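/- Let N ∈ ℕ, c₀, C₁, C₂, a > 0, b ≥ 0 and q ≥ 0. Let (ℓ_j)_{j∈ℕ} be real numbers with ℓ_j ≥ c₀ for all j and #{j : ℓ_j ≤ R} ≤ C₁·e^{aR} for every R > 0. For each j ∈ ℕ and k ∈ ℕ let B_{j,k} ∈ M_N(ℂ) with ‖B_{j,k}‖ ≤ C₂·(1+k)^q·e^{(b−k)ℓ_j}. Then for every s ∈ ℂ with Re(s) > a + b the double family (j,k) ↦ det(I_N − e^{−sℓ_j}·B_{j,k}) is multipliable, with Σ_{j,k} ‖B_{j,k}‖·e^{−Re(s)ℓ_j} < ∞, and the resulting product is a holomorphic function of s on {s : Re(s) > a + b}. -/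

import Mathlib

open scoped Matrix.Norms.L2Operator

open Filter Topology Asymptotics

/-- Counting with exponential rate `a` makes `∑ exp (-t ℓ j)` converge for `t > a`. -/
theorem summable_exp_neg_mul_of_ncard_le {ι : Type*} {ℓ : ι → ℝ} {a t C : ℝ}
    (ht : a < t) (ht₀ : 0 ≤ t) (hℓ : ∀ j, 0 ≤ ℓ j)
    (hcount : ∀ R > (0 : ℝ), {j | ℓ j ≤ R}.Finite ∧
      ({j | ℓ j ≤ R}.ncard : ℝ) ≤ C * Real.exp (a * R)) :
    Summable fun j => Real.exp (-t * ℓ j) := by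
  classical
  set g : ℕ → ℝ := fun n => C * Real.exp (a * (n + 1)) * Real.exp (-t * n) with hg
  have hg_nonneg (n : ℕ) : 0 ≤ g n :=
    mul_nonneg ((Nat.cast_nonneg _).trans (hcount (n + 1) (by positivity)).2) (Real.exp_nonneg _)
  have hg_summable : Summable g := by
    have h := (Real.summable_exp_nat_mul_iff.mpr (sub_neg.mpr ht)).mul_left (C * Real.exp a)
    refine h.congr fun n => ?_
    simp only [hg, mul_assoc, ← Real.exp_add]
    ring_nf
  refine summable_of_sum_le (c := ∑' n, g n) (fun j => Real.exp_nonneg _) fun u => ?_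
  calc ∑ j ∈ u, Real.exp (-t * ℓ j)
      = ∑ n ∈ u.image (fun j => ⌊ℓ j⌋₊), ∑ j ∈ u with ⌊ℓ j⌋₊ = n, Real.exp (-t * ℓ j) :=
        (Finset.sum_fiberwise_of_maps_to (fun j hj => Finset.mem_image_of_mem _ hj) _).symm
    _ ≤ ∑ n ∈ u.image (fun j => ⌊ℓ j⌋₊), g n := by
        refine Finset.sum_le_sum fun n _ => ?_
        obtain ⟨hfin, hcard⟩ := hcount (n + 1) (by positivity)
        have hsub : ((u.filter fun j => ⌊ℓ j⌋₊ = n : Finset ι) : Set ι) ⊆ {j | ℓ j ≤ n + 1} := by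
          intro j hj
          have hn : ⌊ℓ j⌋₊ = n := (Finset.mem_filter.mp hj).2
          exact hn ▸ (Nat.lt_floor_add_one (ℓ j)).le
        have hle := Set.ncard_le_ncard hsub hfin
        rw [Set.ncard_coe_finset] at hle
        have hterm : ∀ j ∈ u.filter (fun j => ⌊ℓ j⌋₊ = n),
            Real.exp (-t * ℓ j) ≤ Real.exp (-t * n) := by
          intro j hj
          have hn : ⌊ℓ j⌋₊ = n := (Finset.mem_filter.mp hj).2
          have hfloor : (n : ℝ) ≤ ℓ j := hn ▸ Nat.floor_le (hℓ j)
          exact Real.exp_le_exp.mpr (mul_le_mul_of_nonpos_left hfloor (neg_nonpos.mpr ht₀))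
        refine (Finset.sum_le_card_nsmul _ _ _ hterm).trans ?_
        rw [nsmul_eq_mul]
        exact mul_le_mul_of_nonneg_right ((Nat.cast_le.mpr hle).trans hcard) (Real.exp_nonneg _)
    _ ≤ ∑' n, g n := hg_summable.sum_le_tsum _ fun n _ => hg_nonneg n

theorem summable_one_add_rpow_mul_exp_neg {c : ℝ} (hc : 0 < c) (q : ℝ) :
    Summable fun k : ℕ => (1 + (k : ℝ)) ^ q * Real.exp (-c * k) := by
  obtain ⟨m, hm⟩ := exists_nat_ge q
  have h := ((summable_nat_add_iff 1).mpr
    (Real.summable_pow_mul_exp_neg_nat_mul m hc)).mul_left (Real.exp c)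
  refine h.of_nonneg_of_le (fun k => by positivity) fun k => ?_
  calc (1 + (k : ℝ)) ^ q * Real.exp (-c * k)
      ≤ (1 + (k : ℝ)) ^ (m : ℝ) * Real.exp (-c * k) :=
        mul_le_mul_of_nonneg_right (Real.rpow_le_rpow_of_exponent_le (by simp) hm)
          (Real.exp_nonneg _)
    _ = Real.exp c * (((k + 1 : ℕ) : ℝ) ^ m * Real.exp (-c * (k + 1 : ℕ))) := by
        rw [Real.rpow_natCast, mul_left_comm, ← Real.exp_add]
        push_cast
        ring_nf

theorem Matrix.differentiable_det {n : Type*} [Fintype n] [DecidableEq n] :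
    Differentiable ℂ (Matrix.det : Matrix n n ℂ → ℂ) := by
  have hentry (i j : n) : Differentiable ℂ fun A : Matrix n n ℂ => A i j :=
    (LinearMap.toContinuousLinearMap (Matrix.entryLinearMap ℂ ℂ i j)).differentiable
  have hdet : (Matrix.det : Matrix n n ℂ → ℂ) =
      fun A => ∑ σ : Equiv.Perm n, ((σ.sign : ℤ) : ℂ) * ∏ i, A (σ i) i :=
    funext Matrix.det_apply'
  rw [hdet]
  fun_prop

theorem Matrix.isBigO_det_one_sub_sub_one {n : Type*} [Fintype n] [DecidableEq n] :
    (fun A : Matrix n n ℂ => (1 - A).det - 1) =O[𝓝 0] fun A => A := by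
  have h : DifferentiableAt ℂ (fun A : Matrix n n ℂ => (1 - A).det) 0 :=
    (Matrix.differentiable_det.comp (differentiable_id.const_sub 1)).differentiableAt
  simpa using h.hasFDerivAt.isBigO_sub

section

variable {ι n : Type*} [Fintype n] [DecidableEq n] {ℓ : ι → ℝ} {B : ι → Matrix n n ℂ} {σ : ℝ}

theorem norm_cexp_neg_mul_smul_le {x : ℝ} (hx : 0 ≤ x) (A : Matrix n n ℂ) {s : ℂ}
    (hs : σ ≤ s.re) :
    ‖Complex.exp (-s * (x : ℂ)) • A‖ ≤ ‖A‖ * Real.exp (-σ * x) := by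
  rw [norm_smul, Complex.norm_exp, mul_comm]
  gcongr
  simpa using mul_le_mul_of_nonneg_right hs hx

/-- Absolute convergence on the line `Re s = σ` gives locally uniform convergence of the
determinant product on the half-plane to its right. -/
theorem hasProdLocallyUniformlyOn_det_one_sub_cexp_smul (hℓ : ∀ i, 0 ≤ ℓ i)
    (hsum : Summable fun i => ‖B i‖ * Real.exp (-σ * ℓ i)) :
    HasProdLocallyUniformlyOn
      (fun i (s : ℂ) => Matrix.det (1 - Complex.exp (-s * (ℓ i : ℂ)) • B i))
      (fun s => ∏' i, Matrix.det (1 - Complex.exp (-s * (ℓ i : ℂ)) • B i))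
      {s : ℂ | σ < s.re} := by
  obtain ⟨K, hK⟩ := (Matrix.isBigO_det_one_sub_sub_one (n := n)).bound
  obtain ⟨δ, hδ, hball⟩ := Metric.eventually_nhds_iff.mp hK
  have hopen : IsOpen {s : ℂ | σ < s.re} := isOpen_lt continuous_const Complex.continuous_re
  have hbound : ∀ᶠ i in cofinite, ∀ s ∈ {s : ℂ | σ < s.re},
      ‖Matrix.det (1 - Complex.exp (-s * (ℓ i : ℂ)) • B i) - 1‖ ≤
        |K| * (‖B i‖ * Real.exp (-σ * ℓ i)) := by
    filter_upwards [hsum.tendsto_cofinite_zero.eventually_lt_const hδ] with i hi s hs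
    have hle := norm_cexp_neg_mul_smul_le (hℓ i) (B i) (le_of_lt hs)
    refine (hball (by simpa only [dist_zero_right] using hle.trans_lt hi)).trans ?_
    exact mul_le_mul (le_abs_self K) hle (norm_nonneg _) (abs_nonneg K)
  have hcont (i : ι) : ContinuousOn
      (fun s : ℂ => Matrix.det (1 - Complex.exp (-s * (ℓ i : ℂ)) • B i) - 1)
      {s : ℂ | σ < s.re} := by
    refine Continuous.continuousOn ((Matrix.differentiable_det.continuous.comp ?_).sub
      continuous_const)
    fun_prop
  simpa using Summable.hasProdLocallyUniformlyOn_one_add hopen (hsum.mul_left |K|) hbound hcont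

theorem differentiableOn_tprod_det_one_sub_cexp_smul (hℓ : ∀ i, 0 ≤ ℓ i)
    (hsum : Summable fun i => ‖B i‖ * Real.exp (-σ * ℓ i)) :
    DifferentiableOn ℂ
      (fun s : ℂ => ∏' i, Matrix.det (1 - Complex.exp (-s * (ℓ i : ℂ)) • B i))
      {s : ℂ | σ < s.re} := by
  have hfactor (i : ι) : Differentiable ℂ
      fun s : ℂ => Matrix.det (1 - Complex.exp (-s * (ℓ i : ℂ)) • B i) := by
    refine Matrix.differentiable_det.comp ?_
    fun_prop
  refine (hasProdLocallyUniformlyOn_iff_tendstoLocallyUniformlyOn.mp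
    (hasProdLocallyUniformlyOn_det_one_sub_cexp_smul hℓ hsum)).differentiableOn
    (Eventually.of_forall fun u => ?_) (isOpen_lt continuous_const Complex.continuous_re)
  exact (Differentiable.fun_finsetProd fun i _ => hfactor i).differentiableOn

end

/-- Abstract convergence and holomorphy of the twisted Selberg zeta function on a
half-plane `Re s > a + b`. Matrices carry the `ℓ²` operator norm. -/
theorem selberg_zeta_convergence_holomorphy
    (N : ℕ) (c₀ C₁ C₂ a b q : ℝ) (hc₀ : 0 < c₀) (hC₁ : 0 < C₁) (hC₂ : 0 < C₂)
    (ha : 0 < a) (hb : 0 ≤ b) (hq : 0 ≤ q)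
    (ℓ : ℕ → ℝ) (hℓ : ∀ j, c₀ ≤ ℓ j)
    (hcount : ∀ R > (0 : ℝ), {j : ℕ | ℓ j ≤ R}.Finite ∧
      ({j : ℕ | ℓ j ≤ R}.ncard : ℝ) ≤ C₁ * Real.exp (a * R))
    (B : ℕ → ℕ → Matrix (Fin N) (Fin N) ℂ)
    (hB : ∀ j k, ‖B j k‖ ≤ C₂ * (1 + (k : ℝ)) ^ q * Real.exp ((b - k) * ℓ j)) :
    (∀ s : ℂ, a + b < s.re →
        Summable (fun p : ℕ × ℕ => ‖B p.1 p.2‖ * Real.exp (-s.re * ℓ p.1))) ∧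
    (∀ s : ℂ, a + b < s.re →
        Multipliable (fun p : ℕ × ℕ =>
          Matrix.det (1 - Complex.exp (-s * (ℓ p.1 : ℂ)) • B p.1 p.2))) ∧
    DifferentiableOn ℂ
      (fun s : ℂ =>
        ∏' p : ℕ × ℕ, Matrix.det (1 - Complex.exp (-s * (ℓ p.1 : ℂ)) • B p.1 p.2))
      {s : ℂ | a + b < s.re} := by
  have hℓ₀ (j : ℕ) : 0 ≤ ℓ j := hc₀.le.trans (hℓ j)
  have hsum {σ : ℝ} (hσ : a + b < σ) :
      Summable fun p : ℕ × ℕ => ‖B p.1 p.2‖ * Real.exp (-σ * ℓ p.1) := by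
    have hj := summable_exp_neg_mul_of_ncard_le (t := σ - b) (by linarith) (by linarith) hℓ₀ hcount
    have hk := summable_one_add_rpow_mul_exp_neg hc₀ q
    refine ((hj.mul_of_nonneg hk (fun _ => Real.exp_nonneg _)
      (fun _ => by positivity)).mul_left C₂).of_nonneg_of_le (fun p => by positivity) fun p => ?_
    calc ‖B p.1 p.2‖ * Real.exp (-σ * ℓ p.1)
        ≤ C₂ * (1 + (p.2 : ℝ)) ^ q * Real.exp ((b - p.2) * ℓ p.1) * Real.exp (-σ * ℓ p.1) := by
          gcongr
          exact hB p.1 p.2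
      _ = C₂ * (1 + (p.2 : ℝ)) ^ q *
            (Real.exp (-(σ - b) * ℓ p.1) * Real.exp (-ℓ p.1 * p.2)) := by
          rw [mul_assoc, ← Real.exp_add, ← Real.exp_add]
          ring_nf
      _ ≤ C₂ * (1 + (p.2 : ℝ)) ^ q *
            (Real.exp (-(σ - b) * ℓ p.1) * Real.exp (-c₀ * p.2)) := by
          gcongr
          exact hℓ p.1
      _ = C₂ * (Real.exp (-(σ - b) * ℓ p.1) *
            ((1 + (p.2 : ℝ)) ^ q * Real.exp (-c₀ * p.2))) := by ring
  refine ⟨fun s hs => hsum hs, fun s hs => ?_, fun s hs => ?_⟩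
  all_goals obtain ⟨σ, hσ, hσs⟩ := exists_between (show a + b < s.re from hs)
  · exact ((hasProdLocallyUniformlyOn_det_one_sub_cexp_smul (fun p : ℕ × ℕ => hℓ₀ p.1)
      (hsum hσ)).hasProd hσs).multipliable
  · exact ((differentiableOn_tprod_det_one_sub_cexp_smul (fun p : ℕ × ℕ => hℓ₀ p.1)
      (hsum hσ)).differentiableAt ((isOpen_lt continuous_const
        Complex.continuous_re).mem_nhds hσs)).differentiableWithinAt
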